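/- Let K_1, K_2, K_3 be the 8×2 complex matrices K_1 = (1/6)·[[3√2,0],[0,√2],[0,√2],[0,0],[0,√2],[0,0],[0,0],[0,0]], K_2 = (1/6)·[[0,0],[0,0],[0,0],[√2,0],[0,0],[√2,0],[√2,0],[0,3√2]], K_3 = (1/3)·[[0,0],[1,0],[1,0],[0,1],[1,0],[0,1],[0,1],[0,0]]. Then (i) Σ_{i=1}^3 K_i†K_i = 1_2, and (ii) for every unit vector ψ ∈ ℂ², writing E(ρ) = Σ_i K_i ρ K_i†, each of the three single-qubit reduced output states ρ_j = tr_{¬j}[E(|ψ⟩⟨ψ|)] (j = 1,2,3) satisfies ⟨ψ| ρ_j |ψ⟩ = 7/9. -/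

import Mathlib

open Matrix

noncomputable section

/-- Encode a triple `(b₁,b₂,b₃) ∈ {0,1}³` as the index `4b₁+2b₂+b₃ ∈ Fin 8`. -/
def tri (a b c : Fin 2) : Fin 8 := ⟨4 * a.val + 2 * b.val + c.val, by omega⟩

/-- The rank-one projector `|φ⟩⟨φ|`. -/
def outer {d : ℕ} (φ : Fin d → ℂ) : Matrix (Fin d) (Fin d) ℂ :=
  Matrix.of fun i j => φ i * star (φ j)

/-- `⟨ψ| M |ψ⟩`. -/
def fid {d : ℕ} (ψ : Fin d → ℂ) (M : Matrix (Fin d) (Fin d) ℂ) : ℂ :=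
  ∑ i, ∑ j, star (ψ i) * M i j * ψ j

/-- Reduced state of qubit 1 of a three-qubit state. -/
def red₁ (M : Matrix (Fin 8) (Fin 8) ℂ) : Matrix (Fin 2) (Fin 2) ℂ :=
  Matrix.of fun b b' => ∑ x : Fin 2, ∑ y : Fin 2, M (tri b x y) (tri b' x y)

/-- Reduced state of qubit 2 of a three-qubit state. -/
def red₂ (M : Matrix (Fin 8) (Fin 8) ℂ) : Matrix (Fin 2) (Fin 2) ℂ :=
  Matrix.of fun b b' => ∑ x : Fin 2, ∑ y : Fin 2, M (tri x b y) (tri x b' y)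

/-- Reduced state of qubit 3 of a three-qubit state. -/
def red₃ (M : Matrix (Fin 8) (Fin 8) ℂ) : Matrix (Fin 2) (Fin 2) ℂ :=
  Matrix.of fun b b' => ∑ x : Fin 2, ∑ y : Fin 2, M (tri x y b) (tri x y b')

/-- First Kraus operator of the universal 1→3 cloner. -/
def K₁ : Matrix (Fin 8) (Fin 2) ℂ :=
  (1 / 6 : ℂ) • !![((3 * Real.sqrt 2 : ℝ) : ℂ), 0;
    0, ((Real.sqrt 2 : ℝ) : ℂ);
    0, ((Real.sqrt 2 : ℝ) : ℂ);
    0, 0;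
    0, ((Real.sqrt 2 : ℝ) : ℂ);
    0, 0;
    0, 0;
    0, 0]

/-- Second Kraus operator of the universal 1→3 cloner. -/
def K₂ : Matrix (Fin 8) (Fin 2) ℂ :=
  (1 / 6 : ℂ) • !![(0 : ℂ), 0;
    0, 0;
    0, 0;
    ((Real.sqrt 2 : ℝ) : ℂ), 0;
    0, 0;
    ((Real.sqrt 2 : ℝ) : ℂ), 0;
    ((Real.sqrt 2 : ℝ) : ℂ), 0;
    0, ((3 * Real.sqrt 2 : ℝ) : ℂ)]

/-- Third Kraus operator of the universal 1→3 cloner. -/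
def K₃ : Matrix (Fin 8) (Fin 2) ℂ :=
  (1 / 3 : ℂ) • !![(0 : ℂ), 0; 1, 0; 1, 0; 0, 1; 1, 0; 0, 1; 0, 1; 0, 0]

/-- The channel output `E(|ψ⟩⟨ψ|) = ∑ᵢ Kᵢ |ψ⟩⟨ψ| Kᵢ†`. -/
def Eout (ψ : Fin 2 → ℂ) : Matrix (Fin 8) (Fin 8) ℂ :=
  K₁ * outer ψ * K₁ᴴ + K₂ * outer ψ * K₂ᴴ + K₃ * outer ψ * K₃ᴴ

theorem ofReal_sqrt_two_sq : ((Real.sqrt 2 : ℝ) : ℂ) ^ 2 = 2 := by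
  rw [← Complex.ofReal_pow, Real.sq_sqrt (by norm_num)]
  norm_num

/-- The Kraus operators satisfy the completeness relation. -/
theorem kraus_completeness : K₁ᴴ * K₁ + K₂ᴴ * K₂ + K₃ᴴ * K₃ = 1 := by
  ext i j
  fin_cases i <;> fin_cases j <;>
    simp [K₁, K₂, K₃, Matrix.mul_apply, Fin.sum_univ_succ, Complex.conj_ofNat] <;>
    linear_combination (1 / 3 : ℂ) * ofReal_sqrt_two_sq

theorem mul_outer_mul_conjTranspose {m n : ℕ} (K : Matrix (Fin m) (Fin n) ℂ) (ψ : Fin n → ℂ) :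
    K * outer ψ * Kᴴ = outer (K *ᵥ ψ) := by
  have h (d : ℕ) (φ : Fin d → ℂ) : outer φ = vecMulVec φ (star φ) := rfl
  rw [h, h, mul_vecMulVec, vecMulVec_mul, star_mulVec]

theorem outer_smul {d : ℕ} (c : ℂ) (φ : Fin d → ℂ) :
    outer (c • φ) = (c * star c) • outer φ := by
  ext i j
  simp [outer]
  ring

theorem K₁_mulVec (ψ : Fin 2 → ℂ) :
    K₁ *ᵥ ψ = (((Real.sqrt 2 : ℝ) : ℂ) / 6) • ![3 * ψ 0, ψ 1, ψ 1, 0, ψ 1, 0, 0, 0] := by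
  ext i
  fin_cases i <;> simp [K₁, Matrix.mulVec, dotProduct, -mul_eq_mul_right_iff] <;> ring

theorem K₂_mulVec (ψ : Fin 2 → ℂ) :
    K₂ *ᵥ ψ = (((Real.sqrt 2 : ℝ) : ℂ) / 6) • ![0, 0, 0, ψ 0, 0, ψ 0, ψ 0, 3 * ψ 1] := by
  ext i
  fin_cases i <;> simp [K₂, Matrix.mulVec, dotProduct, -mul_eq_mul_right_iff] <;> ring

theorem K₃_mulVec (ψ : Fin 2 → ℂ) :
    K₃ *ᵥ ψ = (1 / 3 : ℂ) • ![0, ψ 0, ψ 0, ψ 1, ψ 0, ψ 1, ψ 1, 0] := by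
  ext i
  fin_cases i <;> simp [K₃, Matrix.mulVec, dotProduct]

theorem Eout_eq (ψ : Fin 2 → ℂ) :
    Eout ψ = (1 / 18 : ℂ) • outer ![3 * ψ 0, ψ 1, ψ 1, 0, ψ 1, 0, 0, 0] +
      (1 / 18 : ℂ) • outer ![0, 0, 0, ψ 0, 0, ψ 0, ψ 0, 3 * ψ 1] +
      (1 / 9 : ℂ) • outer ![0, ψ 0, ψ 0, ψ 1, ψ 0, ψ 1, ψ 1, 0] := by
  have h₂ : ((Real.sqrt 2 : ℝ) : ℂ) / 6 * star (((Real.sqrt 2 : ℝ) : ℂ) / 6) = 1 / 18 := by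
    simp only [Complex.star_def, map_div₀, Complex.conj_ofReal, Complex.conj_ofNat]
    linear_combination (1 / 36 : ℂ) * ofReal_sqrt_two_sq
  have h₃ : (1 / 3 : ℂ) * star (1 / 3 : ℂ) = 1 / 9 := by
    simp only [Complex.star_def, map_div₀, map_one, Complex.conj_ofNat]
    norm_num
  simp only [Eout, mul_outer_mul_conjTranspose, K₁_mulVec, K₂_mulVec, K₃_mulVec, outer_smul, h₂, h₃]

/-- The reduced state of qubit 1 is the input shrunk by the factor `5 / 9`. -/
theorem red₁_Eout (ψ : Fin 2 → ℂ) :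
    red₁ (Eout ψ) = (5 / 9 : ℂ) • outer ψ + (2 / 9 * (outer ψ).trace) • 1 := by
  ext i j
  fin_cases i <;> fin_cases j <;>
    simp [red₁, Eout_eq, outer, tri, Matrix.trace, Complex.conj_ofNat] <;>
    ring

/-- The reduced state of qubit 2 is the input shrunk by the factor `5 / 9`. -/
theorem red₂_Eout (ψ : Fin 2 → ℂ) :
    red₂ (Eout ψ) = (5 / 9 : ℂ) • outer ψ + (2 / 9 * (outer ψ).trace) • 1 := by
  ext i j
  fin_cases i <;> fin_cases j <;>
    simp [red₂, Eout_eq, outer, tri, Matrix.trace, Complex.conj_ofNat] <;>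
    ring

/-- The reduced state of qubit 3 is the input shrunk by the factor `5 / 9`. -/
theorem red₃_Eout (ψ : Fin 2 → ℂ) :
    red₃ (Eout ψ) = (5 / 9 : ℂ) • outer ψ + (2 / 9 * (outer ψ).trace) • 1 := by
  ext i j
  fin_cases i <;> fin_cases j <;>
    simp [red₃, Eout_eq, outer, tri, Matrix.trace, Complex.conj_ofNat] <;>
    ring

/-- The fidelity of the shrunk state with a unit vector. -/
theorem fid_shrunk (ψ : Fin 2 → ℂ) (hψ : ∑ i, ‖ψ i‖ ^ 2 = 1) :
    fid ψ ((5 / 9 : ℂ) • outer ψ + (2 / 9 * (outer ψ).trace) • 1) = 7 / 9 := by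
  have h : ψ 0 * star (ψ 0) + ψ 1 * star (ψ 1) = 1 := by
    rw [Fin.sum_univ_two] at hψ
    simp only [Complex.star_def, Complex.mul_conj']
    exact_mod_cast hψ
  simp only [fid, outer, Matrix.trace, Fin.sum_univ_two, Matrix.add_apply, Matrix.smul_apply,
    Matrix.of_apply, Matrix.diag_apply, smul_eq_mul, Matrix.one_apply_eq, ne_eq, zero_ne_one,
    one_ne_zero, not_false_eq_true, Matrix.one_apply_ne]
  linear_combination (7 / 9 : ℂ) * (ψ 0 * star (ψ 0) + ψ 1 * star (ψ 1) + 1) * h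

/-- The universal 1→3 cloner: the three Kraus operators satisfy completeness, and
each of the three single-qubit reduced output states has fidelity `7/9` with the
input for every unit vector `ψ`. -/
theorem universal_one_to_three_cloner :
    K₁ᴴ * K₁ + K₂ᴴ * K₂ + K₃ᴴ * K₃ = 1 ∧
    ∀ ψ : Fin 2 → ℂ, (∑ i, ‖ψ i‖ ^ 2 = 1) →
      fid ψ (red₁ (Eout ψ)) = 7 / 9 ∧
      fid ψ (red₂ (Eout ψ)) = 7 / 9 ∧
      fid ψ (red₃ (Eout ψ)) = 7 / 9 := by
  refine ⟨kraus_completeness, fun ψ hψ => ?_⟩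
  rw [red₁_Eout, red₂_Eout, red₃_Eout]
  exact ⟨fid_shrunk ψ hψ, fid_shrunk ψ hψ, fid_shrunk ψ hψ⟩
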